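/- Let x, y, z ∈ ℝ² be affinely independent, and let S be a finite set of points contained in the open triangle △xyz such that S ∪ {x, y, z} is in general position. Then for every natural number m with m ≤ |S|, there exists a point v on the closed segment [y, z] such that N_S(△xyv) = m. -/

import Mathlib

open scoped Classical

/-- Number of points of `S` strictly inside the triangle with vertices `a`, `b`, `c`
(the interior of the convex hull of `{a, b, c}`). -/
noncomputable def NTri (S : Finset (ℝ × ℝ)) (a b c : ℝ × ℝ) : ℕ :=
  (S.filter (fun p => p ∈ interior (convexHull ℝ ({a, b, c} : Set (ℝ × ℝ))))).card

/-- A set of points in the plane is in general position if no three distinct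
points of it are collinear. -/
def GenPos (P : Set (ℝ × ℝ)) : Prop :=
  ∀ p ∈ P, ∀ q ∈ P, ∀ r ∈ P,
    p ≠ q → p ≠ r → q ≠ r → ¬ Collinear ℝ ({p, q, r} : Set (ℝ × ℝ))

theorem Finset.exists_card_filter_lt_eq {α : Type*} [LinearOrder α] (T : Finset α) :
    ∀ a : α, (∀ b ∈ T, b < a) → ∀ m ≤ T.card,
      ∃ t, (t ∈ T ∨ t = a) ∧ (T.filter (fun b => b < t)).card = m := by
  induction T using Finset.induction_on_max with
  | empty =>
    intro a _ m hm
    exact ⟨a, Or.inr rfl, by simpa [eq_comm] using hm⟩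
  | insert b T hb ih =>
    intro a ha m hm
    have hbT : b ∉ T := fun h => lt_irrefl _ (hb b h)
    rcases Nat.lt_or_ge T.card m with h | h
    · refine ⟨a, Or.inr rfl, ?_⟩
      rw [Finset.filter_true_of_mem ha]
      rw [Finset.card_insert_of_notMem hbT] at hm ⊢
      omega
    · obtain ⟨t, ht, hc⟩ := ih b hb m h
      have htb : t ≤ b := ht.elim (fun h => (hb t h).le) le_of_eq
      refine ⟨t, Or.inl ?_, ?_⟩
      · rcases ht with ht | rfl <;> simp [*]
      · rwa [Finset.filter_insert, if_neg (not_lt.2 htb)]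

theorem AffineIndependent.eq_of_combination_eq {a b c : ℝ × ℝ}
    (h : AffineIndependent ℝ ![a, b, c]) {α β γ α' β' γ' : ℝ}
    (hs : α + β + γ = α' + β' + γ')
    (he : α • a + β • b + γ • c = α' • a + β' • b + γ' • c) :
    α = α' ∧ β = β' ∧ γ = γ' := by
  rw [affineIndependent_iff] at h
  have := h Finset.univ ![α - α', β - β', γ - γ']
    (by simp [Fin.sum_univ_three]; linarith)
    (by
      simp only [Fin.sum_univ_three, Matrix.cons_val]
      rw [← sub_eq_zero] at he
      rw [← he]
      module)
  have h0 := this 0 (Finset.mem_univ _)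
  have h1 := this 1 (Finset.mem_univ _)
  have h2 := this 2 (Finset.mem_univ _)
  simp only [Matrix.cons_val] at h0 h1 h2
  exact ⟨by linarith, by linarith, by linarith⟩

theorem AffineIndependent.mem_interior_triangle_iff {a b c : ℝ × ℝ}
    (h : AffineIndependent ℝ ![a, b, c]) (p : ℝ × ℝ) :
    p ∈ interior (convexHull ℝ ({a, b, c} : Set (ℝ × ℝ))) ↔
      ∃ α β γ : ℝ, 0 < α ∧ 0 < β ∧ 0 < γ ∧ α + β + γ = 1 ∧
        p = α • a + β • b + γ • c := by
  have htop : affineSpan ℝ (Set.range ![a, b, c]) = ⊤ := by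
    rw [h.affineSpan_eq_top_iff_card_eq_finrank_add_one]
    simp
  let B : AffineBasis (Fin 3) ℝ (ℝ × ℝ) := ⟨![a, b, c], h, htop⟩
  have hr : ({a, b, c} : Set (ℝ × ℝ)) = Set.range B := by
    change _ = Set.range ![a, b, c]
    ext q
    simp [eq_comm, or_comm, or_left_comm]
  have hsum := B.sum_coord_apply_eq_one p
  have hcomb := B.linear_combination_coord_eq_self p
  simp only [Fin.sum_univ_three] at hsum hcomb
  have hcomb' : B.coord 0 p • a + B.coord 1 p • b + B.coord 2 p • c = p := hcomb
  rw [hr, B.interior_convexHull, Set.mem_ofPred_eq]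
  constructor
  · intro hp
    exact ⟨_, _, _, hp 0, hp 1, hp 2, hsum, hcomb'.symm⟩
  · rintro ⟨α, β, γ, hα, hβ, hγ, hs, rfl⟩
    obtain ⟨h0, h1, h2⟩ := h.eq_of_combination_eq (hsum.trans hs.symm) hcomb'
    intro i
    fin_cases i
    · exact h0.symm ▸ hα
    · exact h1.symm ▸ hβ
    · exact h2.symm ▸ hγ

theorem AffineIndependent.replace_third {x y z : ℝ × ℝ}
    (h : AffineIndependent ℝ ![x, y, z]) {t : ℝ} (ht : 0 < t) :
    AffineIndependent ℝ ![x, y, (1 - t) • y + t • z] := by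
  rw [affineIndependent_iff_of_fintype]
  intro w hw h0
  rw [Finset.univ.weightedVSub_eq_linear_combination hw] at h0
  simp only [Fin.sum_univ_three, Matrix.cons_val] at hw h0
  obtain ⟨h1, h2, h3⟩ := h.eq_of_combination_eq
    (α := w 0) (β := w 1 + w 2 * (1 - t)) (γ := w 2 * t) (α' := 0) (β' := 0) (γ' := 0)
    (by linarith) (by simp only [zero_smul, add_zero]; rw [← h0]; module)
  have hw2 : w 2 = 0 := by simpa [ht.ne'] using h3
  rw [hw2, zero_mul, add_zero] at h2
  intro i
  fin_cases i <;> assumption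

theorem AffineIndependent.mem_interior_subtriangle_iff {x y z : ℝ × ℝ}
    (h : AffineIndependent ℝ ![x, y, z]) {t : ℝ} (ht : 0 < t) {α β γ : ℝ}
    (hα : 0 < α) (hβ : 0 < β) (hγ : 0 < γ) (hs : α + β + γ = 1) :
    α • x + β • y + γ • z ∈
        interior (convexHull ℝ ({x, y, (1 - t) • y + t • z} : Set (ℝ × ℝ))) ↔
      γ / (β + γ) < t := by
  rw [(h.replace_third ht).mem_interior_triangle_iff, div_lt_iff₀ (by positivity)]
  constructor
  · rintro ⟨α', β', γ', -, hβ', hγ', hs', he⟩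
    obtain ⟨-, rfl, rfl⟩ := h.eq_of_combination_eq
      (α := α) (β := β) (γ := γ) (α' := α') (β' := β' + γ' * (1 - t)) (γ' := γ' * t)
      (by linarith) (by rw [he]; module)
    nlinarith [mul_pos ht hβ']
  · intro hlt
    refine ⟨α, β + γ - γ / t, γ / t, hα, ?_, by positivity, by linarith, ?_⟩
    · rw [sub_pos, div_lt_iff₀ ht]
      linarith
    · have hγt : γ / t * t = γ := div_mul_cancel₀ _ ht.ne'
      generalize γ / t = g at *
      subst hγt
      module

/-- Existence of a point `v` on the closed segment `[y,z]` cutting off exactly `m`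
points of `S` in the open triangle `△xyv`, for each `m ≤ |S|`. -/
theorem stmt7 (x y z : ℝ × ℝ) (hxyz : AffineIndependent ℝ ![x, y, z])
    (S : Finset (ℝ × ℝ))
    (hS : ∀ p ∈ S, p ∈ interior (convexHull ℝ ({x, y, z} : Set (ℝ × ℝ))))
    (hgp : GenPos ((S : Set (ℝ × ℝ)) ∪ {x, y, z}))
    (m : ℕ) (hm : m ≤ S.card) :
    ∃ v ∈ segment ℝ y z, NTri S x y v = m := by
  have hS' := fun p hp => (hxyz.mem_interior_triangle_iff p).1 (hS p hp)
  choose! α β γ hα hβ hγ hs he using hS'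
  have hne : ∀ p ∈ S, x ≠ p := by
    intro p hp hxp
    have := (hxyz.eq_of_combination_eq (α := 1) (β := 0) (γ := 0)
      (α' := α p) (β' := β p) (γ' := γ p) (by simp [hs p hp])
      (by rw [← he p hp, ← hxp]; simp)).2.1
    exact (hβ p hp).ne this
  set r : ℝ × ℝ → ℝ := fun p => γ p / (β p + γ p) with hr
  have hr0 : ∀ p ∈ S, 0 < r p := fun p hp =>
    div_pos (hγ p hp) (add_pos (hβ p hp) (hγ p hp))
  have hr1 : ∀ p ∈ S, r p < 1 := fun p hp => by
    rw [hr, div_lt_one (add_pos (hβ p hp) (hγ p hp))]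
    linarith [hβ p hp]
  have hray : ∀ p ∈ S, p = (β p + γ p) • (y + r p • (z - y) - x) + x := by
    intro p hp
    have h1 : γ p = r p * (β p + γ p) :=
      (div_mul_cancel₀ _ (add_pos (hβ p hp) (hγ p hp)).ne').symm
    have h2 : α p = 1 - (β p + γ p) := by linarith [hs p hp]
    conv_lhs => rw [he p hp]
    linear_combination (norm := module) h1 • (z - y) + h2 • x
  have hinj : Set.InjOn r S := by
    intro p hp q hq hpq
    by_contra hne'
    refine hgp x (by simp) p (Or.inl hp) q (Or.inl hq) (hne p hp) (hne q hq) hne' ?_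
    rw [collinear_iff_of_mem (p₀ := x) (by simp)]
    refine ⟨y + r p • (z - y) - x, ?_⟩
    rintro _ (rfl | rfl | rfl)
    · exact ⟨0, by simp⟩
    · exact ⟨_, hray _ hp⟩
    · exact ⟨_, by rw [hpq]; exact hray _ hq⟩
  obtain ⟨t, ht, hc⟩ := (S.image r).exists_card_filter_lt_eq 1
    (Finset.forall_mem_image.2 hr1) m (by rwa [Finset.card_image_of_injOn hinj])
  have ht01 : 0 < t ∧ t ≤ 1 := by
    rcases ht with ht | rfl
    · obtain ⟨p, hp, rfl⟩ := Finset.mem_image.1 ht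
      exact ⟨hr0 p hp, (hr1 p hp).le⟩
    · simp
  refine ⟨(1 - t) • y + t • z, ⟨1 - t, t, by linarith, ht01.1.le, by ring, rfl⟩, ?_⟩
  rw [Finset.filter_image, Finset.card_image_of_injOn
    (hinj.mono (Finset.coe_subset.2 (Finset.filter_subset _ _)))] at hc
  rw [NTri, ← hc]
  congr 1
  refine Finset.filter_congr fun p hp => ?_
  conv_lhs => rw [he p hp]
  exact hxyz.mem_interior_subtriangle_iff ht01.1 (hα p hp) (hβ p hp) (hγ p hp) (hs p hp)
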